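/- arXiv:1009.1585 — 2 statements merged into one kernel-verified Lean document; each statement's English description precedes it below -/
import Mathlib

section
/- Let x̄ ∉ Ω with T(x̄) < ∞, and suppose T is well posed at x̄, i.e., for every sequence x_k → x̄ with T(x_k) → T(x̄) there exist projection points w_k ∈ Π(x_k) containing a norm-convergent subsequence. Then ∂T(x̄) ⊆ ⋃_{w̄ ∈ Π(x̄)} [(−∂ρ_F(w̄ − x̄)) ∩ N(w̄; Ω)] and ∂^∞ T(x̄) ⊆ ⋃_{w̄ ∈ Π(x̄)} [(−∂^∞ ρ_F(w̄ − x̄)) ∩ N(w̄; Ω)] ⊆ ⋃_{w̄ ∈ Π(x̄)} [N(w̄; Ω) ∩ F*_+], where F*_+ := {x* ∈ X* : ⟨x*, v⟩ ≥ 0 for all v ∈ F}. -/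
open Set Filter Topology Pointwise
open scoped ENNReal

variable {X : Type*}

/-- Minimal time function `T(x) = inf{t ≥ 0 : Ω ∩ (x + tF) ≠ ∅}`, with `inf ∅ = ∞`. -/
noncomputable def mtime [NormedAddCommGroup X] [NormedSpace ℝ X]
    (Ω F : Set X) (x : X) : ℝ≥0∞ :=
  ⨅ (t : ℝ) (_ : 0 ≤ t ∧ ∃ q ∈ F, x + t • q ∈ Ω), ENNReal.ofReal t

/-- Minkowski gauge `ρ_F(u) = inf{t ≥ 0 : u ∈ tF}`, with `inf ∅ = ∞`. -/
noncomputable def mgauge [NormedAddCommGroup X] [NormedSpace ℝ X]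
    (F : Set X) (u : X) : ℝ≥0∞ :=
  ⨅ (t : ℝ) (_ : 0 ≤ t ∧ ∃ q ∈ F, u = t • q), ENNReal.ofReal t

/-- Enlargement `Ω_r = {x : T(x) ≤ r}` of the target set. -/
noncomputable def enl [NormedAddCommGroup X] [NormedSpace ℝ X]
    (Ω F : Set X) (r : ℝ) : Set X :=
  {x | mtime Ω F x ≤ ENNReal.ofReal r}

/-- Generalized (minimal time) projection `Π(x) = (x + T(x)·F) ∩ Ω`. -/
noncomputable def mproj [NormedAddCommGroup X] [NormedSpace ℝ X]
    (Ω F : Set X) (x : X) : Set X :=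
  {w | w ∈ Ω ∧ ∃ q ∈ F, w = x + (mtime Ω F x).toReal • q}

/-- Support function `σ_F(x*) = sup_{q ∈ F} ⟨x*, q⟩`. -/
noncomputable def suppFn [NormedAddCommGroup X] [NormedSpace ℝ X]
    (F : Set X) (p : X →L[ℝ] ℝ) : ℝ :=
  sSup ((fun q => p q) '' F)

/-- Dynamics bound `‖F‖ = sup{‖q‖ : q ∈ F}`. -/
noncomputable def dynBound [NormedAddCommGroup X] (F : Set X) : ℝ :=
  sSup ((fun q => ‖q‖) '' F)

/-- Fréchet `ε`-subdifferential of `φ` at `xb`: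
`liminf_{x→xb} (φ(x) − φ(xb) − ⟨x*, x−xb⟩)/‖x−xb‖ ≥ −ε`. -/
def fsub [NormedAddCommGroup X] [NormedSpace ℝ X]
    (φ : X → ℝ≥0∞) (ε : ℝ) (xb : X) : Set (X →L[ℝ] ℝ) :=
  {p | ∀ γ > (0:ℝ), ∃ δ > (0:ℝ), ∀ x, ‖x - xb‖ < δ →
    ENNReal.ofReal ((φ xb).toReal + p (x - xb) - (ε + γ) * ‖x - xb‖) ≤ φ x}

/-- Set of `ε`-normals to `Θ` at `xb ∈ Θ`. -/
def enormal [NormedAddCommGroup X] [NormedSpace ℝ X]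
    (Θ : Set X) (ε : ℝ) (xb : X) : Set (X →L[ℝ] ℝ) :=
  {p | ∀ γ > (0:ℝ), ∃ δ > (0:ℝ), ∀ x ∈ Θ, ‖x - xb‖ < δ →
    p (x - xb) ≤ (ε + γ) * ‖x - xb‖}

/-- Basic (limiting/Mordukhovich) normal cone. -/
def bnormal [NormedAddCommGroup X] [NormedSpace ℝ X]
    (Θ : Set X) (xb : X) : Set (X →L[ℝ] ℝ) :=
  {p | ∃ (ε : ℕ → ℝ) (x : ℕ → X) (ps : ℕ → X →L[ℝ] ℝ),
    (∀ k, 0 ≤ ε k) ∧ Tendsto ε atTop (𝓝 0) ∧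
    (∀ k, x k ∈ Θ) ∧ Tendsto x atTop (𝓝 xb) ∧
    (∀ k, ps k ∈ enormal Θ (ε k) (x k)) ∧
    (∀ v, Tendsto (fun k => ps k v) atTop (𝓝 (p v)))}

/-- Basic (limiting/Mordukhovich) subdifferential. -/
def bsub [NormedAddCommGroup X] [NormedSpace ℝ X]
    (φ : X → ℝ≥0∞) (xb : X) : Set (X →L[ℝ] ℝ) :=
  {p | ∃ (ε : ℕ → ℝ) (x : ℕ → X) (ps : ℕ → X →L[ℝ] ℝ),
    (∀ k, 0 ≤ ε k) ∧ Tendsto ε atTop (𝓝 0) ∧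
    Tendsto x atTop (𝓝 xb) ∧
    Tendsto (fun k => φ (x k)) atTop (𝓝 (φ xb)) ∧
    (∀ k, ps k ∈ fsub φ (ε k) (x k)) ∧
    (∀ v, Tendsto (fun k => ps k v) atTop (𝓝 (p v)))}

/-- Singular (Mordukhovich) subdifferential. -/
def ssub [NormedAddCommGroup X] [NormedSpace ℝ X]
    (φ : X → ℝ≥0∞) (xb : X) : Set (X →L[ℝ] ℝ) :=
  {p | ∃ (ε lam : ℕ → ℝ) (x : ℕ → X) (ps : ℕ → X →L[ℝ] ℝ),
    (∀ k, 0 ≤ ε k) ∧ Tendsto ε atTop (𝓝 0) ∧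
    (∀ k, 0 < lam k) ∧ Tendsto lam atTop (𝓝 0) ∧
    Tendsto x atTop (𝓝 xb) ∧
    Tendsto (fun k => φ (x k)) atTop (𝓝 (φ xb)) ∧
    (∀ k, ps k ∈ fsub φ (ε k) (x k)) ∧
    (∀ v, Tendsto (fun k => lam k * ps k v) atTop (𝓝 (p v)))}

/-- Subdifferential of convex analysis (for `ℝ≥0∞`-valued convex functions,
finite at the reference point). -/
def csub [NormedAddCommGroup X] [NormedSpace ℝ X]
    (φ : X → ℝ≥0∞) (xb : X) : Set (X →L[ℝ] ℝ) :=
  {p | ∀ x, ENNReal.ofReal (p (x - xb) + (φ xb).toReal) ≤ φ x}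

/-- Normal cone of convex analysis. -/
def cnormal [NormedAddCommGroup X] [NormedSpace ℝ X]
    (Θ : Set X) (xb : X) : Set (X →L[ℝ] ℝ) :=
  {p | ∀ x ∈ Θ, p (x - xb) ≤ 0}

section MinimalTime

variable [NormedAddCommGroup X] [NormedSpace ℝ X] {Ω F : Set X}

theorem mtime_le_mgauge {x w : X} (hw : w ∈ Ω) : mtime Ω F x ≤ mgauge F (w - x) := by
  refine le_iInf₂ fun t ⟨ht, q, hq, h⟩ => iInf₂_le t ⟨ht, q, hq, ?_⟩
  rw [← h]
  simpa using hw

theorem mtime_eq_zero_of_mem (hF : F.Nonempty) {x : X} (hx : x ∈ Ω) : mtime Ω F x = 0 := by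
  obtain ⟨q, hq⟩ := hF
  have h : mtime Ω F x ≤ ENNReal.ofReal 0 := iInf₂_le 0 ⟨le_rfl, q, hq, by simpa using hx⟩
  simpa using h

theorem mtime_ne_top_of_mem_mproj {x w : X} (hw : w ∈ mproj Ω F x) : mtime Ω F x ≠ ⊤ := by
  intro htop
  obtain ⟨hwΩ, q, hq, h⟩ := hw
  simp only [htop, ENNReal.toReal_top, zero_smul, add_zero] at h
  rw [mtime_eq_zero_of_mem ⟨q, hq⟩ (h ▸ hwΩ)] at htop
  exact ENNReal.zero_ne_top htop

theorem mgauge_sub_eq_mtime {x w : X} (hw : w ∈ mproj Ω F x) :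
    mgauge F (w - x) = mtime Ω F x := by
  have hfin := mtime_ne_top_of_mem_mproj hw
  obtain ⟨hwΩ, q, hq, h⟩ := hw
  refine le_antisymm ?_ (mtime_le_mgauge hwΩ)
  have hle : mgauge F (w - x) ≤ ENNReal.ofReal (mtime Ω F x).toReal :=
    iInf₂_le _ ⟨ENNReal.toReal_nonneg, q, hq, by rw [sub_eq_iff_eq_add', ← h]⟩
  rwa [ENNReal.ofReal_toReal hfin] at hle

theorem neg_mem_fsub_mgauge {x w : X} {ε : ℝ} {p : X →L[ℝ] ℝ} (hw : w ∈ mproj Ω F x)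
    (hp : p ∈ fsub (mtime Ω F) ε x) : -p ∈ fsub (mgauge F) ε (w - x) := by
  intro γ hγ
  obtain ⟨δ, hδ, h⟩ := hp γ hγ
  refine ⟨δ, hδ, fun u hu => ?_⟩
  have hsub : w - u - x = -(u - (w - x)) := by abel
  have hnorm : ‖w - u - x‖ = ‖u - (w - x)‖ := by rw [hsub, norm_neg]
  have hle := (h (w - u) (by rwa [hnorm])).trans (mtime_le_mgauge (F := F) hw.1)
  rw [hnorm, hsub, map_neg, sub_sub_cancel] at hle
  rwa [mgauge_sub_eq_mtime hw, neg_apply]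

theorem mem_enormal_of_mem_fsub_mtime {x w : X} {ε : ℝ} {p : X →L[ℝ] ℝ}
    (hw : w ∈ mproj Ω F x) (hp : p ∈ fsub (mtime Ω F) ε x) : p ∈ enormal Ω ε w := by
  intro γ hγ
  obtain ⟨δ, hδ, h⟩ := hp γ hγ
  refine ⟨δ, hδ, fun y hy hyw => ?_⟩
  have hsub : x + (y - w) - x = y - w := add_sub_cancel_left _ _
  have hle := (h (x + (y - w)) (by rwa [hsub])).trans (mtime_le_mgauge (F := F) hy)
  rw [hsub, show y - (x + (y - w)) = w - x by abel, mgauge_sub_eq_mtime hw,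
    ENNReal.ofReal_le_iff_le_toReal (mtime_ne_top_of_mem_mproj hw)] at hle
  linarith

theorem smul_mem_enormal {Θ : Set X} {w : X} {ε c : ℝ} {p : X →L[ℝ] ℝ} (hc : 0 < c)
    (hp : p ∈ enormal Θ ε w) : c • p ∈ enormal Θ (c * ε) w := by
  intro γ hγ
  obtain ⟨δ, hδ, h⟩ := hp (γ / c) (div_pos hγ hc)
  refine ⟨δ, hδ, fun y hy hyw => ?_⟩
  have hle := mul_le_mul_of_nonneg_left (h y hy hyw) hc.le
  have hmul : c * ((ε + γ / c) * ‖y - w‖) = (c * ε + γ) * ‖y - w‖ := by field_simp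
  rwa [hmul] at hle

theorem mgauge_add_smul_le (hF : Convex ℝ F) {u v : X} (hv : v ∈ F) {s : ℝ} (hs : 0 ≤ s) :
    mgauge F (u + s • v) ≤ mgauge F u + ENNReal.ofReal s := by
  unfold mgauge
  simp only [ENNReal.iInf_add]
  refine le_iInf₂ fun t ⟨ht, q, hq, h⟩ => ?_
  rw [← ENNReal.ofReal_add ht hs]
  have hmem : t • q + s • v ∈ (t + s) • F := by
    rw [hF.add_smul ht hs]
    exact add_mem_add (smul_mem_smul_set hq) (smul_mem_smul_set hv)
  obtain ⟨q', hq', hq'eq⟩ := hmem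
  exact iInf₂_le (t + s) ⟨by positivity, q', hq', by rw [h]; exact hq'eq.symm⟩

theorem apply_le_of_mem_fsub_mgauge (hF : Convex ℝ F) {u v : X} (hv : v ∈ F) {ε : ℝ}
    {p : X →L[ℝ] ℝ} (hu : mgauge F u ≠ ⊤) (hp : p ∈ fsub (mgauge F) ε u) :
    p v ≤ 1 + (ε + 1) * ‖v‖ := by
  obtain ⟨δ, hδ, h⟩ := hp 1 one_pos
  obtain ⟨s, hs, hsv⟩ : ∃ s > 0, s * ‖v‖ < δ := by
    refine ⟨δ / (‖v‖ + 1), by positivity, ?_⟩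
    rw [div_mul_eq_mul_div, div_lt_iff₀ (by positivity)]
    nlinarith [norm_nonneg v]
  have hnorm : ‖s • v‖ = s * ‖v‖ := by rw [norm_smul, Real.norm_of_nonneg hs.le]
  have hle := (h (u + s • v) (by rwa [add_sub_cancel_left, hnorm])).trans
    (mgauge_add_smul_le hF hv hs.le)
  rw [add_sub_cancel_left, hnorm, map_smul, smul_eq_mul,
    ENNReal.ofReal_le_iff_le_toReal (by simp [hu]),
    ENNReal.toReal_add hu ENNReal.ofReal_ne_top, ENNReal.toReal_ofReal hs.le] at hle
  refine le_of_mul_le_mul_left ?_ hs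
  linarith

theorem mem_mproj_of_tendsto (hΩ : IsClosed Ω) (hF : IsClosed F) {x w : ℕ → X} {xb wb : X}
    (hpos : 0 < (mtime Ω F xb).toReal) (hx : Tendsto x atTop (𝓝 xb))
    (hT : Tendsto (fun k => mtime Ω F (x k)) atTop (𝓝 (mtime Ω F xb)))
    (hw : ∀ k, w k ∈ mproj Ω F (x k)) (hwb : Tendsto w atTop (𝓝 wb)) :
    wb ∈ mproj Ω F xb := by
  refine ⟨hΩ.mem_of_tendsto hwb (Eventually.of_forall fun k => (hw k).1), ?_⟩
  have hTr : Tendsto (fun k => (mtime Ω F (x k)).toReal) atTop (𝓝 (mtime Ω F xb).toReal) :=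
    (ENNReal.tendsto_toReal (ENNReal.toReal_pos_iff.1 hpos).2.ne).comp hT
  have hq := (hTr.inv₀ hpos.ne').smul (hwb.sub hx)
  refine ⟨_, hF.mem_of_tendsto hq ?_, ?_⟩
  · filter_upwards [hTr.eventually_ne hpos.ne'] with k hk
    obtain ⟨-, q, hqF, h⟩ := hw k
    rwa [h, add_sub_cancel_left, inv_smul_smul₀ hk]
  · rw [smul_inv_smul₀ hpos.ne', add_sub_cancel]

theorem apply_nonneg_of_neg_mem_ssub_mgauge (hF : Convex ℝ F) {u : X} (hu : mgauge F u ≠ ⊤)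
    {p : X →L[ℝ] ℝ} (hp : -p ∈ ssub (mgauge F) u) {v : X} (hv : v ∈ F) : 0 ≤ p v := by
  obtain ⟨ε, lam, y, ps, -, hε, hlam, hlam0, -, hy, hps, hlim⟩ := hp
  have hbound : Tendsto (fun k => lam k * (1 + (ε k + 1) * ‖v‖)) atTop (𝓝 0) := by
    simpa using hlam0.mul (((hε.add_const 1).mul_const ‖v‖).const_add 1)
  have hle : (-p) v ≤ 0 := by
    refine le_of_tendsto_of_tendsto (hlim v) hbound ?_
    filter_upwards [hy.eventually_ne hu] with k hk
    exact mul_le_mul_of_nonneg_left (apply_le_of_mem_fsub_mgauge hF hv hk (hps k)) (hlam k).le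
  simpa using hle

end MinimalTime

/-- Theorem 6.3: basic and singular subgradients of minimal time functions at
out-of-set points via projections, under well-posedness of `T` at `x̄`. -/
theorem bsub_ssub_mtime_outset_proj [NormedAddCommGroup X] [NormedSpace ℝ X]
    [CompleteSpace X]
    (Ω F : Set X) (hΩne : Ω.Nonempty) (hΩcl : IsClosed Ω)
    (hFne : F.Nonempty) (hFcl : IsClosed F) (hFbd : Bornology.IsBounded F)
    (hFcv : Convex ℝ F)
    (xb : X) (hxb : xb ∉ Ω) (hfin : mtime Ω F xb < ⊤)
    (hwp : ∀ x : ℕ → X, Tendsto x atTop (𝓝 xb) →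
      Tendsto (fun k => mtime Ω F (x k)) atTop (𝓝 (mtime Ω F xb)) →
      ∃ w : ℕ → X, (∀ k, w k ∈ mproj Ω F (x k)) ∧
        ∃ (φ : ℕ → ℕ) (wb : X), StrictMono φ ∧ Tendsto (w ∘ φ) atTop (𝓝 wb)) :
    (bsub (mtime Ω F) xb ⊆
      ⋃ wb ∈ mproj Ω F xb, ((-(bsub (mgauge F) (wb - xb))) ∩ bnormal Ω wb)) ∧
    (ssub (mtime Ω F) xb ⊆
      ⋃ wb ∈ mproj Ω F xb, ((-(ssub (mgauge F) (wb - xb))) ∩ bnormal Ω wb)) ∧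
    ((⋃ wb ∈ mproj Ω F xb, ((-(ssub (mgauge F) (wb - xb))) ∩ bnormal Ω wb)) ⊆
      ⋃ wb ∈ mproj Ω F xb, (bnormal Ω wb ∩ {p | ∀ v ∈ F, 0 ≤ p v})) := by
  have hpos : 0 < (mtime Ω F xb).toReal := by
    refine ENNReal.toReal_pos (fun h0 => hxb ?_) hfin.ne
    obtain ⟨w, hw, -⟩ := hwp (fun _ => xb) tendsto_const_nhds tendsto_const_nhds
    obtain ⟨hwΩ, q, -, h⟩ := hw 0
    simp only [h0, ENNReal.toReal_zero, zero_smul, add_zero] at h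
    exact h ▸ hwΩ
  refine ⟨?_, ?_, ?_⟩
  · rintro p ⟨ε, x, ps, hε, hε0, hx, hT, hps, hlim⟩
    obtain ⟨w, hw, φ, wb, hφ, hwb⟩ := hwp x hx hT
    have hφ' := hφ.tendsto_atTop
    have hmem := mem_mproj_of_tendsto hΩcl hFcl hpos (hx.comp hφ') (hT.comp hφ')
      (fun k => hw (φ k)) hwb
    refine mem_iUnion₂.2 ⟨wb, hmem, ?_, ?_⟩
    · refine ⟨ε ∘ φ, fun k => w (φ k) - x (φ k), fun k => -ps (φ k), fun k => hε _,
        hε0.comp hφ', hwb.sub (hx.comp hφ'), ?_,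
        fun k => neg_mem_fsub_mgauge (hw _) (hps _), fun v => ((hlim v).comp hφ').neg⟩
      simp only [mgauge_sub_eq_mtime (hw _), mgauge_sub_eq_mtime hmem]
      exact hT.comp hφ'
    · exact ⟨ε ∘ φ, w ∘ φ, ps ∘ φ, fun k => hε _, hε0.comp hφ', fun k => (hw _).1, hwb,
        fun k => mem_enormal_of_mem_fsub_mtime (hw _) (hps _), fun v => (hlim v).comp hφ'⟩
  · rintro p ⟨ε, lam, x, ps, hε, hε0, hlam, hlam0, hx, hT, hps, hlim⟩
    obtain ⟨w, hw, φ, wb, hφ, hwb⟩ := hwp x hx hT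
    have hφ' := hφ.tendsto_atTop
    have hmem := mem_mproj_of_tendsto hΩcl hFcl hpos (hx.comp hφ') (hT.comp hφ')
      (fun k => hw (φ k)) hwb
    refine mem_iUnion₂.2 ⟨wb, hmem, ?_, ?_⟩
    · refine ⟨ε ∘ φ, lam ∘ φ, fun k => w (φ k) - x (φ k), fun k => -ps (φ k), fun k => hε _,
        hε0.comp hφ', fun k => hlam _, hlam0.comp hφ', hwb.sub (hx.comp hφ'), ?_,
        fun k => neg_mem_fsub_mgauge (hw _) (hps _), fun v => ?_⟩
      · simp only [mgauge_sub_eq_mtime (hw _), mgauge_sub_eq_mtime hmem]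
        exact hT.comp hφ'
      · simpa [Function.comp_def] using ((hlim v).comp hφ').neg
    · refine ⟨fun k => lam (φ k) * ε (φ k), w ∘ φ, fun k => lam (φ k) • ps (φ k),
        fun k => mul_nonneg (hlam _).le (hε _), ?_, fun k => (hw _).1, hwb,
        fun k => smul_mem_enormal (hlam _) (mem_enormal_of_mem_fsub_mtime (hw _) (hps _)),
        fun v => (hlim v).comp hφ'⟩
      simpa using (hlam0.comp hφ').mul (hε0.comp hφ')
  · refine iUnion₂_mono fun wb hwb p hp => ⟨hp.2, fun v hv => ?_⟩
    refine apply_nonneg_of_neg_mem_ssub_mgauge hFcv ?_ hp.1 hv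
    rw [mgauge_sub_eq_mtime hwb]
    exact hfin.ne
end

section
/- Suppose the target set Ω (equivalently the minimal time function T) is convex. Then: (i) for every x̄ ∈ Ω, the subdifferential of convex analysis satisfies ∂T(x̄) = N(x̄; Ω) ∩ C*, where N(x̄; Ω) := {x* ∈ X* : ⟨x*, x − x̄⟩ ≤ 0 for all x ∈ Ω} and C* := {x* ∈ X* : σ_F(−x*) ≤ 1}; (ii) for every x̄ ∉ Ω with r := T(x̄) < ∞, one has ∂T(x̄) = N(x̄; Ω_r) ∩ S*, where S* := {x* ∈ X* : σ_F(−x*) = 1}. -/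
open Set Filter Topology Pointwise
open scoped ENNReal

variable {X : Type*}

section MinimalTime

variable [NormedAddCommGroup X] [NormedSpace ℝ X] {Ω F : Set X}

theorem mtime_le_ofReal {x q : X} {t : ℝ} (ht : 0 ≤ t) (hq : q ∈ F) (h : x + t • q ∈ Ω) :
    mtime Ω F x ≤ ENNReal.ofReal t :=
  iInf₂_le t ⟨ht, q, hq, h⟩

theorem ofReal_le_mtime_iff {x : X} {c : ℝ} :
    ENNReal.ofReal c ≤ mtime Ω F x ↔
      ∀ t : ℝ, 0 ≤ t → ∀ q ∈ F, x + t • q ∈ Ω → c ≤ t := by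
  constructor
  · intro h t ht q hq hx
    exact (ENNReal.ofReal_le_ofReal_iff ht).1 (h.trans (mtime_le_ofReal ht hq hx))
  · intro h
    refine le_iInf₂ fun t ⟨ht, q, hq, hx⟩ => ENNReal.ofReal_le_ofReal (h t ht q hq hx)

theorem le_toReal_mtime {x : X} {c : ℝ} (hx : mtime Ω F x ≠ ⊤)
    (h : ∀ t : ℝ, 0 ≤ t → ∀ q ∈ F, x + t • q ∈ Ω → c ≤ t) :
    c ≤ (mtime Ω F x).toReal :=
  (ENNReal.ofReal_le_iff_le_toReal hx).1 (ofReal_le_mtime_iff.2 h)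

theorem mem_csub_mtime_iff {xb : X} {p : X →L[ℝ] ℝ} :
    p ∈ csub (mtime Ω F) xb ↔
      ∀ x : X, ∀ t : ℝ, 0 ≤ t → ∀ q ∈ F, x + t • q ∈ Ω →
        p (x - xb) + (mtime Ω F xb).toReal ≤ t :=
  forall_congr' fun _ => ofReal_le_mtime_iff

theorem mtime_ne_zero_of_notMem (hΩ : IsClosed Ω) (hF : Bornology.IsBounded F) {x : X}
    (hx : x ∉ Ω) : mtime Ω F x ≠ 0 := by
  intro h0
  obtain ⟨M, hM, hFM⟩ := hF.exists_pos_norm_le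
  refine hx (hΩ.closure_subset (Metric.mem_closure_iff.2 fun ε hε => ?_))
  by_contra! hfar
  have hle : ε / M ≤ (mtime Ω F x).toReal := by
    refine le_toReal_mtime (by simp [h0]) fun t ht q hq hxt => ?_
    have h := hfar _ hxt
    rw [dist_self_add_right, norm_smul, Real.norm_of_nonneg ht] at h
    rw [div_le_iff₀ hM]
    exact h.trans (mul_le_mul_of_nonneg_left (hFM q hq) ht)
  have : 0 < ε / M := div_pos hε hM
  simp only [h0, ENNReal.toReal_zero] at hle
  linarith

/-- Moving backwards along the dynamics for time `s` can be undone in time `s`. -/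
theorem exists_mem_sub_smul_add_smul_eq (hF : Convex ℝ F) {s t : ℝ} (hs : 0 ≤ s) (ht : 0 ≤ t)
    {q q' : X} (hq : q ∈ F) (hq' : q' ∈ F) (x : X) :
    ∃ q'' ∈ F, x - s • q + (s + t) • q'' = x + t • q' := by
  have h : s • q + t • q' ∈ (s + t) • F := by
    rw [hF.add_smul hs ht]
    exact Set.add_mem_add (Set.smul_mem_smul_set hq) (Set.smul_mem_smul_set hq')
  obtain ⟨q'', hq'', he⟩ := h
  refine ⟨q'', hq'', ?_⟩
  simp only at he
  rw [he]
  abel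

theorem le_suppFn (hF : Bornology.IsBounded F) (p : X →L[ℝ] ℝ) {q : X} (hq : q ∈ F) :
    p q ≤ suppFn F p := by
  obtain ⟨M, hFM⟩ := hF.exists_norm_le
  refine le_csSup ⟨‖p‖ * M, ?_⟩ ⟨q, hq, rfl⟩
  rintro _ ⟨y, hy, rfl⟩
  exact (le_abs_self _).trans (p.le_opNorm_of_le (hFM y hy))

theorem suppFn_le (hF : F.Nonempty) {p : X →L[ℝ] ℝ} {c : ℝ} (h : ∀ q ∈ F, p q ≤ c) :
    suppFn F p ≤ c :=
  csSup_le (hF.image _) (by rintro _ ⟨q, hq, rfl⟩; exact h q hq)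

theorem suppFn_neg_le_one_of_mem_csub_mtime (hFne : F.Nonempty) (hF : Convex ℝ F) {xb : X}
    (hxb : mtime Ω F xb ≠ ⊤) {p : X →L[ℝ] ℝ} (hp : p ∈ csub (mtime Ω F) xb) :
    suppFn F (-p) ≤ 1 := by
  rw [mem_csub_mtime_iff] at hp
  refine suppFn_le hFne fun q hq => ?_
  have hle : -p q + (mtime Ω F xb).toReal - 1 ≤ (mtime Ω F xb).toReal := by
    refine le_toReal_mtime hxb fun t ht q' hq' hxt => ?_
    obtain ⟨q'', hq'', he⟩ := exists_mem_sub_smul_add_smul_eq hF zero_le_one ht hq hq' xb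
    have h := hp _ (1 + t) (by linarith) q'' hq'' (he ▸ hxt)
    simp only [one_smul, sub_sub_cancel_left, map_neg] at h
    linarith
  simp only [neg_apply]
  linarith

theorem one_le_suppFn_neg_of_mem_csub_mtime (hF : Bornology.IsBounded F) {xb : X}
    (hxb : mtime Ω F xb ≠ ⊤) (hxb0 : mtime Ω F xb ≠ 0) {p : X →L[ℝ] ℝ}
    (hp : p ∈ csub (mtime Ω F) xb) : 1 ≤ suppFn F (-p) := by
  rw [mem_csub_mtime_iff] at hp
  have hr : 0 < (mtime Ω F xb).toReal := ENNReal.toReal_pos hxb0 hxb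
  set r := (mtime Ω F xb).toReal
  set σ := suppFn F (-p)
  have hfeas : ∀ t : ℝ, 0 ≤ t → ∀ q ∈ F, xb + t • q ∈ Ω → r ≤ t * σ := by
    intro t ht q hq hxt
    have h := hp (xb + t • q) 0 le_rfl q hq (by simpa using hxt)
    have hσ := mul_le_mul_of_nonneg_left (le_suppFn hF (-p) hq) ht
    simp only [add_sub_cancel_left, map_smul, smul_eq_mul] at h
    simp only [neg_apply] at hσ
    linarith
  by_contra! hlt
  rcases le_or_gt σ 0 with hσ | hσ
  · have h : r + 1 ≤ r := le_toReal_mtime hxb fun t ht q hq hxt => by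
      nlinarith [hfeas t ht q hq hxt]
    linarith
  · have h : r / σ ≤ r := le_toReal_mtime hxb fun t ht q hq hxt =>
      (div_le_iff₀ hσ).2 (hfeas t ht q hq hxt)
    rw [div_le_iff₀ hσ] at h
    nlinarith

theorem csub_mtime_of_mem (hFne : F.Nonempty) (hFbd : Bornology.IsBounded F)
    (hFcv : Convex ℝ F) {xb : X} (hxb : xb ∈ Ω) :
    csub (mtime Ω F) xb = cnormal Ω xb ∩ {p | suppFn F (-p) ≤ 1} := by
  have h0 : mtime Ω F xb = 0 := mtime_eq_zero_of_mem hFne hxb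
  ext p
  constructor
  · intro hp
    refine ⟨fun x hx => ?_, suppFn_neg_le_one_of_mem_csub_mtime hFne hFcv (by simp [h0]) hp⟩
    obtain ⟨q, hq⟩ := hFne
    simpa [h0] using mem_csub_mtime_iff.1 hp x 0 le_rfl q hq (by simpa using hx)
  · rintro ⟨hN, hσ : suppFn F (-p) ≤ 1⟩
    refine mem_csub_mtime_iff.2 fun x t ht q hq hx => ?_
    have h := hN _ hx
    have hq1 := mul_le_mul_of_nonneg_left ((le_suppFn hFbd (-p) hq).trans hσ) ht
    simp only [neg_apply] at hq1
    simp only [map_sub, map_add, map_smul, smul_eq_mul] at h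
    simp only [map_sub, h0, ENNReal.toReal_zero]
    linarith

theorem csub_mtime_of_notMem (hΩcl : IsClosed Ω) (hFne : F.Nonempty)
    (hFbd : Bornology.IsBounded F) (hFcv : Convex ℝ F) {xb : X} (hxb : xb ∉ Ω)
    (hfin : mtime Ω F xb ≠ ⊤) :
    csub (mtime Ω F) xb =
      cnormal (enl Ω F (mtime Ω F xb).toReal) xb ∩ {p | suppFn F (-p) = 1} := by
  have h0 : mtime Ω F xb ≠ 0 := mtime_ne_zero_of_notMem hΩcl hFbd hxb
  ext p
  constructor
  · intro hp
    refine ⟨fun x hx => ?_, le_antisymm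
      (suppFn_neg_le_one_of_mem_csub_mtime hFne hFcv hfin hp)
      (one_le_suppFn_neg_of_mem_csub_mtime hFbd hfin h0 hp)⟩
    have h := (hp x).trans hx
    rw [ENNReal.ofReal_le_ofReal_iff ENNReal.toReal_nonneg] at h
    linarith
  · rintro ⟨hN, hσ : suppFn F (-p) = 1⟩
    refine mem_csub_mtime_iff.2 fun x t ht q hq hx => ?_
    have hr : 0 ≤ (mtime Ω F xb).toReal := ENNReal.toReal_nonneg
    set r := (mtime Ω F xb).toReal
    rcases le_or_gt r t with hrt | hrt
    · have hmem : x + (t - r) • q ∈ enl Ω F r :=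
        mtime_le_ofReal hr hq (by rwa [add_assoc, ← add_smul, sub_add_cancel])
      have h := hN _ hmem
      have hq1 := mul_le_mul_of_nonneg_left (le_suppFn hFbd (-p) hq) (sub_nonneg.2 hrt)
      simp only [hσ, neg_apply] at hq1
      simp only [map_sub, map_add, map_smul, smul_eq_mul] at h
      simp only [map_sub]
      linarith
    · have hpos : 0 < r - t := sub_pos.2 hrt
      have hle : suppFn F (-p) ≤ -p (x - xb) / (r - t) := by
        refine suppFn_le hFne fun q' hq' => ?_
        obtain ⟨q'', hq'', he⟩ := exists_mem_sub_smul_add_smul_eq hFcv hpos.le ht hq' hq x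
        rw [sub_add_cancel] at he
        have h := hN _ (mtime_le_ofReal hr hq'' (he ▸ hx) : x - (r - t) • q' ∈ enl Ω F r)
        rw [le_div_iff₀ hpos]
        simp only [map_sub, map_smul, smul_eq_mul] at h
        simp only [neg_apply, map_sub]
        linarith
      rw [hσ, le_div_iff₀ hpos] at hle
      linarith

end MinimalTime

/-- Theorem 7.1: basic subgradients of convex minimal time functions:
(i) at in-set points `∂T(x̄) = N(x̄; Ω) ∩ C*`;
(ii) at out-of-set points with `r = T(x̄) < ∞`, `∂T(x̄) = N(x̄; Ω_r) ∩ S*`. -/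
theorem csub_mtime_convex [NormedAddCommGroup X] [NormedSpace ℝ X]
    [CompleteSpace X]
    (Ω F : Set X) (hΩne : Ω.Nonempty) (hΩcl : IsClosed Ω)
    (hFne : F.Nonempty) (hFcl : IsClosed F) (hFbd : Bornology.IsBounded F)
    (hFcv : Convex ℝ F) (hΩcv : Convex ℝ Ω) :
    (∀ xb ∈ Ω,
      csub (mtime Ω F) xb = cnormal Ω xb ∩ {p | suppFn F (-p) ≤ 1}) ∧
    (∀ xb : X, xb ∉ Ω → mtime Ω F xb < ⊤ →
      csub (mtime Ω F) xb =
        cnormal (enl Ω F (mtime Ω F xb).toReal) xb ∩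
          {p | suppFn F (-p) = 1}) := by
  exact ⟨fun _ hxb => csub_mtime_of_mem hFne hFbd hFcv hxb,
    fun _ hxb hfin => csub_mtime_of_notMem hΩcl hFne hFbd hFcv hxb hfin.ne⟩
end
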